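/- arXiv:2110.09708 — 3 statements merged into one kernel-verified Lean document; each statement's English description precedes it below -/
import Mathlib

section
/- Let θ ∈ (0,1) and let f : ℝ → ℂ be continuous on ℝ, continuously differentiable on ℝ ∖ {0}, and satisfy ‖f‖_{S_{1,θ}} < ∞. Then for all x, y ∈ ℝ one has |f(x) − f(y)| ≤ (2/θ)·‖f‖_{S_{1,θ}}·|x − y|^θ; in particular, every function in S_{1,θ} is θ-Hölder. -/
/-- If `‖g'‖ ≤ M t ^ (θ - 1)` on `(0, ∞)`, then `g` is `θ`-Hölder on `[0, ∞)`
with constant `M / θ`. -/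
theorem norm_sub_le_of_norm_deriv_le_rpow {E : Type*} [NormedAddCommGroup E] [NormedSpace ℝ E]
    {θ M : ℝ} (hθ : θ ∈ Set.Ioc (0 : ℝ) 1) (hM : 0 ≤ M) {g g' : ℝ → E} (hg : Continuous g)
    (hg' : ∀ t, 0 < t → HasDerivAt g (g' t) t)
    (hbound : ∀ t, 0 < t → ‖g' t‖ ≤ M * t ^ (θ - 1)) {a b : ℝ} (ha : 0 ≤ a) (hab : a ≤ b) :
    ‖g b - g a‖ ≤ M / θ * (b - a) ^ θ := by
  have hθ0 : θ ≠ 0 := hθ.1.ne'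
  have hrpow : Continuous fun t : ℝ => t ^ θ := Real.continuous_rpow_const hθ.1.le
  have key : ∀ c, 0 < c → c ≤ b → ‖g b - g c‖ ≤ M / θ * (b ^ θ - c ^ θ) := by
    intro c hc hcb
    have hB : ∀ t, 0 < t →
        HasDerivAt (fun t : ℝ => M / θ * (t ^ θ - c ^ θ)) (M * t ^ (θ - 1)) t := by
      intro t ht
      have h := ((Real.hasDerivAt_rpow_const (p := θ) (Or.inl ht.ne')).sub_const
        (c ^ θ)).const_mul (M / θ)
      rwa [← mul_assoc, div_mul_cancel₀ _ hθ0] at h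
    refine image_norm_le_of_norm_deriv_right_le_deriv_boundary' (f := fun t => g t - g c)
      (f' := g') (a := c) (b := b) (by fun_prop)
      (fun t ht => ((hg' t (hc.trans_le ht.1)).sub_const _).hasDerivWithinAt)
      (B := fun t => M / θ * (t ^ θ - c ^ θ)) (by simp) (by fun_prop)
      (fun t ht => (hB t (hc.trans_le ht.1)).hasDerivWithinAt)
      (fun t ht => hbound t (hc.trans_le ht.1)) ⟨hcb, le_rfl⟩
  have main : ‖g b - g a‖ ≤ M / θ * (b ^ θ - a ^ θ) := by
    rcases hab.eq_or_lt with rfl | hlt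
    · simp
    refine ContinuousWithinAt.closure_le (s := Set.Ioo a b) (x := a)
      (f := fun c => ‖g b - g c‖) (g := fun c => M / θ * (b ^ θ - c ^ θ)) ?_ ?_ ?_ ?_
    · rw [closure_Ioo hlt.ne]
      exact ⟨le_rfl, hab⟩
    · exact Continuous.continuousWithinAt (by fun_prop)
    · exact Continuous.continuousWithinAt (by fun_prop)
    · exact fun c hc => key c (ha.trans_lt hc.1) hc.2.le
  refine main.trans (mul_le_mul_of_nonneg_left ?_ (div_nonneg hM hθ.1.le))
  have := Real.rpow_add_le_add_rpow ha (sub_nonneg.2 hab) hθ.1.le hθ.2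
  rw [add_sub_cancel] at this
  linarith


/-- Let `θ ∈ (0,1)` and let `f : ℝ → ℂ` be continuous on `ℝ`, continuously
differentiable on `ℝ \ {0}`, and satisfy `‖f‖_{S_{1,θ}} < ∞` (here `M` denotes the norm
`‖f‖_{S_{1,θ}} = max_{0 ≤ k ≤ 1} sup_{x ≠ 0} |x|^{k-θ} |f⁽ᵏ⁾(x)|`, i.e. `M` bounds all the
quantities `|x|^{k-θ} |f⁽ᵏ⁾(x)|` for `k ≤ 1`, `x ≠ 0`).  Then for all `x, y ∈ ℝ`,
`|f(x) − f(y)| ≤ (2/θ) · M · |x − y|^θ`; in particular every function in `S_{1,θ}` is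
`θ`-Hölder. -/
theorem holder_of_S_one_theta
    (θ : ℝ) (hθ : θ ∈ Set.Ioo (0 : ℝ) 1)
    (f : ℝ → ℂ) (hf_cont : Continuous f)
    (hf_diff : ContDiffOn ℝ 1 f {(0 : ℝ)}ᶜ)
    (M : ℝ)
    (hM : ∀ k : ℕ, k ≤ 1 → ∀ x : ℝ, x ≠ 0 →
      |x| ^ ((k : ℝ) - θ) * ‖iteratedDerivWithin k f {(0 : ℝ)}ᶜ x‖ ≤ M) :
    ∀ x y : ℝ, ‖f x - f y‖ ≤ (2 / θ) * M * |x - y| ^ θ := by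
  have hM0 : 0 ≤ M := le_trans (by positivity) (hM 0 zero_le_one 1 one_ne_zero)
  have hopen : IsOpen ({(0 : ℝ)}ᶜ : Set ℝ) := isOpen_compl_singleton
  have hderiv : ∀ t : ℝ, t ≠ 0 → HasDerivAt f (deriv f t) t := fun t ht =>
    ((hf_diff.differentiableOn one_ne_zero).differentiableAt (hopen.mem_nhds ht)).hasDerivAt
  have hbound : ∀ t : ℝ, t ≠ 0 → ‖deriv f t‖ ≤ M * |t| ^ (θ - 1) := by
    intro t ht
    have h := hM 1 le_rfl t ht
    rw [iteratedDerivWithin_one, derivWithin_of_isOpen hopen ht, Nat.cast_one,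
      ← neg_sub θ 1, Real.rpow_neg (abs_nonneg t)] at h
    have hp : 0 < |t| ^ (θ - 1) := Real.rpow_pos_of_pos (abs_pos.2 ht) _
    rwa [inv_mul_le_iff₀ hp, mul_comm] at h
  have hθ' : θ ∈ Set.Ioc (0 : ℝ) 1 := ⟨hθ.1, hθ.2.le⟩
  have hpos : ∀ a b : ℝ, 0 ≤ a → a ≤ b → ‖f b - f a‖ ≤ M / θ * (b - a) ^ θ := fun a b ha hab =>
    norm_sub_le_of_norm_deriv_le_rpow hθ' hM0 hf_cont (fun t ht => hderiv t ht.ne')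
      (fun t ht => by simpa [abs_of_pos ht] using hbound t ht.ne') ha hab
  have hneg : ∀ a b : ℝ, 0 ≤ a → a ≤ b →
      ‖f (-b) - f (-a)‖ ≤ M / θ * (b - a) ^ θ := fun a b ha hab =>
    norm_sub_le_of_norm_deriv_le_rpow (g := fun t => f (-t)) (g' := fun t => -deriv f (-t))
      hθ' hM0 (hf_cont.comp continuous_neg)
      (fun t ht => by
        simpa [Function.comp_def] using (hderiv (-t) (neg_ne_zero.2 ht.ne')).scomp t (hasDerivAt_neg t))
      (fun t ht => by simpa [abs_of_pos ht] using hbound (-t) (neg_ne_zero.2 ht.ne')) ha hab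
  have hC : 0 ≤ M / θ := div_nonneg hM0 hθ.1.le
  have h2 : 2 / θ * M = 2 * (M / θ) := by ring
  have hle : ∀ x y : ℝ, x ≤ y → ‖f x - f y‖ ≤ 2 / θ * M * |x - y| ^ θ := by
    intro x y hxy
    rw [abs_sub_comm, abs_of_nonneg (sub_nonneg.2 hxy), h2]
    have hnn : 0 ≤ M / θ * (y - x) ^ θ :=
      mul_nonneg hC (Real.rpow_nonneg (sub_nonneg.2 hxy) _)
    rcases le_total 0 x with hx | hx
    · have := hpos x y hx hxy
      rw [norm_sub_rev]
      linarith
    rcases le_total y 0 with hy | hy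
    · have := hneg (-y) (-x) (by linarith) (by linarith)
      rw [neg_neg, neg_neg, show -x - -y = y - x by ring] at this
      linarith
    · have h1 := hpos 0 y le_rfl hy
      have h3 := hneg 0 (-x) le_rfl (by linarith)
      rw [neg_neg, neg_zero, sub_zero] at h3
      rw [sub_zero, norm_sub_rev] at h1
      have e1 : M / θ * y ^ θ ≤ M / θ * (y - x) ^ θ :=
        mul_le_mul_of_nonneg_left (Real.rpow_le_rpow hy (by linarith) hθ.1.le) hC
      have e2 : M / θ * (-x) ^ θ ≤ M / θ * (y - x) ^ θ :=
        mul_le_mul_of_nonneg_left (Real.rpow_le_rpow (by linarith) (by linarith) hθ.1.le) hC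
      have := norm_sub_le_norm_sub_add_norm_sub (f x) (f 0) (f y)
      linarith
  intro x y
  rcases le_total x y with h | h
  · exact hle x y h
  · rw [norm_sub_rev, abs_sub_comm]
    exact hle y x h
end

section
/- Let θ ∈ (0,1), let n ≥ 0 be an integer, and let f : ℝ → ℝ be continuous on ℝ, n times continuously differentiable on ℝ ∖ {0}, with f(0) = 0. Suppose there exist positive numbers r, C, ε such that |f^{(n)}(x)| ≥ C·x^{θ−r−n} for all x ∈ (0, ε). Then f is not θ-Hölder, i.e., there is no constant K such that |f(x) − f(y)| ≤ K|x − y|^θ for all x, y ∈ ℝ. -/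
/-- If the `n`-th derivative is at least `M` in absolute value on an interval of length `L`,
then the function itself is at least a constant multiple of `M * L ^ n` at some point of it. -/
theorem exists_le_abs_of_le_abs_iteratedDerivWithin {s : Set ℝ} (hs : IsOpen s) {f : ℝ → ℝ}
    (n : ℕ) (hf : ContDiffOn ℝ n f s) :
    ∃ c : ℝ, 0 < c ∧ ∀ a b M : ℝ, a < b → Set.Icc a b ⊆ s →
      (∀ x ∈ Set.Icc a b, M ≤ |iteratedDerivWithin n f s x|) →
      ∃ z ∈ Set.Icc a b, c * (M * (b - a) ^ n) ≤ |f z| := by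
  induction n with
  | zero =>
    refine ⟨1, one_pos, fun a b M hab _ h => ⟨a, Set.left_mem_Icc.2 hab.le, ?_⟩⟩
    simpa using h a (Set.left_mem_Icc.2 hab.le)
  | succ n ih =>
    obtain ⟨c, hc, ih⟩ := ih (hf.of_le (by exact_mod_cast n.le_succ))
    refine ⟨c / (4 * 4 ^ n), by positivity, fun a b M hab hI h => ?_⟩
    set g := iteratedDerivWithin n f s with hg
    have hder : ∀ x ∈ Set.Icc a b, HasDerivAt g (iteratedDerivWithin (n + 1) f s x) x := by
      intro x hx
      rw [iteratedDerivWithin_succ]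
      exact ((hf.differentiableOn_iteratedDerivWithin (by exact_mod_cast n.lt_succ_self)
        hs.uniqueDiffOn) x (hI hx)).hasDerivWithinAt.hasDerivAt (hs.mem_nhds (hI hx))
    have hquarter : (∀ x ∈ Set.Icc a (a + (b - a) / 4), M * (b - a) / 4 ≤ |g x|) ∨
        ∀ x ∈ Set.Icc (b - (b - a) / 4) b, M * (b - a) / 4 ≤ |g x| := by
      by_contra! hcon
      obtain ⟨⟨p, hp, hgp⟩, q, hq, hgq⟩ := hcon
      have hpq : p < q := by linarith [hp.2, hq.1]
      have hsub : Set.Icc p q ⊆ Set.Icc a b := Set.Icc_subset_Icc hp.1 hq.2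
      obtain ⟨ξ, hξ, hslope⟩ := exists_hasDerivAt_eq_slope g (iteratedDerivWithin (n + 1) f s) hpq
        (fun x hx => (hder x (hsub hx)).continuousAt.continuousWithinAt)
        (fun x hx => hder x (hsub (Set.Ioo_subset_Icc_self hx)))
      have hM := h ξ (hsub (Set.Ioo_subset_Icc_self hξ))
      rw [hslope, abs_div, abs_of_pos (sub_pos.2 hpq), le_div_iff₀ (sub_pos.2 hpq)] at hM
      have hMpos : 0 < M := by
        have : 0 < M * (b - a) := by linarith [abs_nonneg (g p)]
        exact pos_of_mul_pos_left this (sub_pos.2 hab).le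
      have hlen : M * ((b - a) / 2) ≤ M * (q - p) :=
        mul_le_mul_of_nonneg_left (by linarith [hp.2, hq.1]) hMpos.le
      linarith [abs_sub (g q) (g p)]
    have hconst : c / (4 * 4 ^ n) * (M * (b - a) ^ (n + 1)) =
        c * (M * (b - a) / 4 * ((b - a) / 4) ^ n) := by
      rw [div_pow]; field_simp; ring
    rw [hconst]
    rcases hquarter with hl | hr
    · have hsub : Set.Icc a (a + (b - a) / 4) ⊆ Set.Icc a b :=
        Set.Icc_subset_Icc le_rfl (by linarith)
      obtain ⟨z, hz, hfz⟩ := ih _ _ _ (by linarith) (hsub.trans hI) hl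
      exact ⟨z, hsub hz, by simpa using hfz⟩
    · have hsub : Set.Icc (b - (b - a) / 4) b ⊆ Set.Icc a b :=
        Set.Icc_subset_Icc (by linarith) le_rfl
      obtain ⟨z, hz, hfz⟩ := ih _ _ _ (by linarith) (hsub.trans hI) hr
      exact ⟨z, hsub hz, by simpa using hfz⟩

/-- On `[x, 2x]` the power `y ^ p` is comparable to `x ^ p` from below. -/
theorem two_rpow_neg_abs_mul_rpow_le {x y : ℝ} (p : ℝ) (hx : 0 < x)
    (hy : y ∈ Set.Icc x (2 * x)) : 2 ^ (-|p|) * x ^ p ≤ y ^ p := by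
  have ht1 : 1 ≤ y / x := (one_le_div hx).2 hy.1
  have ht2 : y / x ≤ 2 := (div_le_iff₀ hx).2 hy.2
  have hyx : y = y / x * x := by field_simp
  rw [hyx, Real.mul_rpow (by linarith) hx.le]
  gcongr
  calc (2 : ℝ) ^ (-|p|) ≤ (y / x) ^ (-|p|) :=
        Real.rpow_le_rpow_of_nonpos (by linarith) ht2 (by simp)
    _ ≤ (y / x) ^ p := Real.rpow_le_rpow_of_exponent_le ht1 (neg_abs_le p)

/-- Let `θ ∈ (0,1)`, `n ≥ 0` an integer, and `f : ℝ → ℝ` continuous on `ℝ`,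
`n` times continuously differentiable on `ℝ \ {0}`, with `f(0) = 0`.  If there exist positive
`r, C, ε` such that `|f⁽ⁿ⁾(x)| ≥ C·x^{θ−r−n}` for all `x ∈ (0,ε)`, then `f` is not `θ`-Hölder:
there is no constant `K` with `|f(x) − f(y)| ≤ K|x − y|^θ` for all `x, y ∈ ℝ`. -/
theorem not_holder_of_large_derivative
    (θ : ℝ) (hθ : θ ∈ Set.Ioo (0 : ℝ) 1) (n : ℕ)
    (f : ℝ → ℝ) (hf_cont : Continuous f)
    (hf_diff : ContDiffOn ℝ n f {(0 : ℝ)}ᶜ)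
    (hf0 : f 0 = 0)
    (r C ε : ℝ) (hr : 0 < r) (hC : 0 < C) (hε : 0 < ε)
    (hlow : ∀ x ∈ Set.Ioo (0 : ℝ) ε,
      C * x ^ (θ - r - (n : ℝ)) ≤ |iteratedDerivWithin n f {(0 : ℝ)}ᶜ x|) :
    ¬ ∃ K : ℝ, ∀ x y : ℝ, |f x - f y| ≤ K * |x - y| ^ θ := by
  rintro ⟨K, hK⟩
  obtain ⟨c, hc, hlarge⟩ :=
    exists_le_abs_of_le_abs_iteratedDerivWithin isOpen_compl_singleton n hf_diff
  set p := θ - r - (n : ℝ) with hp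
  set A := c * (C * 2 ^ (-|p|)) with hA
  have hApos : 0 < A := by positivity
  have hbound : ∀ x ∈ Set.Ioo 0 (ε / 2), x ^ (-r) ≤ |K| * 2 ^ θ / A := by
    intro x hx
    have hx0 : 0 < x := hx.1
    obtain ⟨z, hz, hfz⟩ := hlarge x (2 * x) (C * 2 ^ (-|p|) * x ^ p) (by linarith)
      (fun y hy => (hx0.trans_le hy.1).ne') (fun y hy => by
        refine le_trans ?_ (hlow y ⟨hx0.trans_le hy.1, by linarith [hy.2, hx.2]⟩)
        rw [mul_assoc]
        exact mul_le_mul_of_nonneg_left (two_rpow_neg_abs_mul_rpow_le p hx0 hy) hC.le)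
    have hz0 : 0 < z := hx0.trans_le hz.1
    have hupper : |f z| ≤ |K| * 2 ^ θ * x ^ θ := by
      calc |f z| ≤ K * z ^ θ := by simpa [hf0, abs_of_pos hz0] using hK z 0
        _ ≤ |K| * (2 * x) ^ θ := by
          gcongr
          · exact le_abs_self K
          · exact hθ.1.le
          · exact hz.2
        _ = |K| * 2 ^ θ * x ^ θ := by
          rw [Real.mul_rpow zero_le_two hx0.le, mul_assoc]
    have hpow : x ^ p * x ^ n = x ^ (-r) * x ^ θ := by
      rw [← Real.rpow_natCast x n, ← Real.rpow_add hx0, ← Real.rpow_add hx0]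
      congr 1
      rw [hp]; ring
    have hxL : 2 * x - x = x := by ring
    have hkey : A * x ^ (-r) * x ^ θ ≤ |K| * 2 ^ θ * x ^ θ := by
      calc A * x ^ (-r) * x ^ θ = c * (C * 2 ^ (-|p|) * x ^ p * (2 * x - x) ^ n) := by
            rw [hxL, mul_assoc A, ← hpow, hA]; ring
        _ ≤ _ := hfz.trans hupper
    rw [le_div_iff₀ hApos, mul_comm]
    exact le_of_mul_le_mul_right hkey (Real.rpow_pos_of_pos hx0 θ)
  have hlim := tendsto_rpow_neg_nhdsGT_zero (y := -r) (by linarith)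
  obtain ⟨x, hxgt, hx⟩ := ((hlim.eventually_gt_atTop (|K| * 2 ^ θ / A)).and
    (Ioo_mem_nhdsGT (half_pos hε))).exists
  exact absurd (hbound x hx) (not_le.2 hxgt)
end

section
/- Let θ ∈ (0,1), 0 < r < θ, ε > 0, and let k ≥ 2 be an integer. Let f : (0,ε) → ℝ be k times differentiable on (0,ε). If there exist a real constant C and a constant c > 0 such that f^{(k)}(x) − C ≥ c·x^{θ−r−k} for all x ∈ (0,ε), then there exist a real constant C′ and a constant c′ > 0 such that C′ − f^{(k−1)}(x) ≥ c′·x^{θ−r−k+1} for all x ∈ (0, ε/2). -/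
/-- If `g' ≥ C + c x^(s-1)` on `(0,ε)` with `s < 0`, then `g` is bounded above on `(0,ε/2)` by a
constant minus a positive multiple of `x^s`. -/
theorem exists_mul_rpow_le_sub_of_hasDerivAt {g g' : ℝ → ℝ} {s ε C c : ℝ} (hs : s < 0)
    (hε : 0 < ε) (hc : 0 < c) (hg : ∀ x ∈ Set.Ioo (0 : ℝ) ε, HasDerivAt g (g' x) x)
    (hlow : ∀ x ∈ Set.Ioo (0 : ℝ) ε, c * x ^ (s - 1) ≤ g' x - C) :
    ∃ C' c' : ℝ, 0 < c' ∧ ∀ x ∈ Set.Ioo (0 : ℝ) (ε / 2), c' * x ^ s ≤ C' - g x := by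
  have hderiv : ∀ x ∈ Set.Ioo (0 : ℝ) ε,
      HasDerivAt (fun y => g y - C * y - c / s * y ^ s) (g' x - C - c * x ^ (s - 1)) x := by
    intro x hx
    have h := ((hg x hx).sub ((hasDerivAt_id x).const_mul C)).sub
      ((Real.hasDerivAt_rpow_const (p := s) (Or.inl hx.1.ne')).const_mul (c / s))
    refine h.congr_deriv ?_
    field_simp [hs.ne]
  have hmono : MonotoneOn (fun y => g y - C * y - c / s * y ^ s) (Set.Ioo 0 ε) := by
    refine monotoneOn_of_deriv_nonneg (convex_Ioo 0 ε)
      (fun x hx => (hderiv x hx).continuousAt.continuousWithinAt) ?_ ?_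
    · rw [interior_Ioo]
      exact fun x hx => (hderiv x hx).differentiableAt.differentiableWithinAt
    · rw [interior_Ioo]
      intro x hx
      rw [(hderiv x hx).deriv]
      exact sub_nonneg.mpr (hlow x hx)
  refine ⟨g (ε / 2) - C * (ε / 2) - c / s * (ε / 2) ^ s + |C| * ε, -(c / s),
    neg_pos.mpr (div_neg_of_pos_of_neg hc hs), fun x ⟨hx0, hx⟩ => ?_⟩
  have hxε : x < ε := by linarith
  have hle := hmono ⟨hx0, hxε⟩ ⟨half_pos hε, half_lt_self hε⟩ hx.le
  have hCx : C * x ≤ |C| * ε :=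
    mul_le_mul (le_abs_self C) hxε.le hx0.le (abs_nonneg C)
  dsimp only at hle
  linarith

/-- Let `θ ∈ (0,1)`, `0 < r < θ`, `ε > 0`, `k ≥ 2` an integer, and let
`f : ℝ → ℝ` be `k` times differentiable on `(0,ε)` (expressed by saying that on `(0,ε)` each
`j`-th derivative within `(0,ε)`, `j < k`, has the `(j+1)`-st derivative within `(0,ε)` as its
derivative).  If there exist a real constant `C` and a constant `c > 0` such that
`f⁽ᵏ⁾(x) − C ≥ c·x^{θ−r−k}` for all `x ∈ (0,ε)`, then there exist a real constant `C′` and a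
constant `c′ > 0` such that `C′ − f⁽ᵏ⁻¹⁾(x) ≥ c′·x^{θ−r−k+1}` for all `x ∈ (0, ε/2)`. -/
theorem inductive_step_derivative_bound
    (θ r ε : ℝ) (hθ : θ ∈ Set.Ioo (0 : ℝ) 1) (hr : 0 < r) (hrθ : r < θ) (hε : 0 < ε)
    (k : ℕ) (hk : 2 ≤ k)
    (f : ℝ → ℝ)
    (hdiff : ∀ j : ℕ, j < k → ∀ x ∈ Set.Ioo (0 : ℝ) ε,
      HasDerivAt (iteratedDerivWithin j f (Set.Ioo (0 : ℝ) ε))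
        (iteratedDerivWithin (j + 1) f (Set.Ioo (0 : ℝ) ε) x) x)
    (C c : ℝ) (hc : 0 < c)
    (hlow : ∀ x ∈ Set.Ioo (0 : ℝ) ε,
      c * x ^ (θ - r - (k : ℝ)) ≤ iteratedDerivWithin k f (Set.Ioo (0 : ℝ) ε) x - C) :
    ∃ C' c' : ℝ, 0 < c' ∧ ∀ x ∈ Set.Ioo (0 : ℝ) (ε / 2),
      c' * x ^ (θ - r - (k : ℝ) + 1) ≤ C' - iteratedDerivWithin (k - 1) f (Set.Ioo (0 : ℝ) ε) x := by
  have hk' : (2 : ℝ) ≤ k := by exact_mod_cast hk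
  have hsucc : k - 1 + 1 = k := by omega
  refine exists_mul_rpow_le_sub_of_hasDerivAt (C := C) (by linarith [hθ.2]) hε hc
    (hdiff (k - 1) (by omega)) fun x hx => ?_
  rw [hsucc, add_sub_cancel_right]
  exact hlow x hx
end
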